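/- arXiv:2103.15920 — 3 statements merged into one kernel-verified Lean document; each statement's English description precedes it below -/
import Mathlib

section
/- For every finite poset P with dim(P) ≥ 2 there exists a finite poset P' such that: (1) P is a subposet of P', the cover graph of P' restricted to the ground set of P equals the cover graph of P, and every element of P' not in P has degree 1 in the cover graph of P'; (2) the height of P' equals the height of P; and (3) dim(P) ≤ dim_{P'}(Min(P'), Max(P')). -/
variable {α : Type*}

/-- A linear extension of the poset induced on ground set `s`. -/
def LinExtOn [PartialOrder α] (s : Set α) (L : α → α → Prop) : Prop :=
  (∀ x ∈ s, L x x) ∧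
  (∀ x ∈ s, ∀ y ∈ s, L x y → L y x → x = y) ∧
  (∀ x ∈ s, ∀ y ∈ s, ∀ z ∈ s, L x y → L y z → L x z) ∧
  (∀ x ∈ s, ∀ y ∈ s, L x y ∨ L y x) ∧
  (∀ x ∈ s, ∀ y ∈ s, x ≤ y → L x y)

/-- The set of incomparable pairs of the poset induced on ground set `s`. -/
def IncOn [PartialOrder α] (s : Set α) : Set (α × α) :=
  {p | p.1 ∈ s ∧ p.2 ∈ s ∧ ¬ p.1 ≤ p.2 ∧ ¬ p.2 ≤ p.1}

/-- `I` is reversible in the poset induced on `s`. -/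
def ReversibleOn [PartialOrder α] (s : Set α) (I : Set (α × α)) : Prop :=
  ∃ L, LinExtOn s L ∧ ∀ p ∈ I, L p.2 p.1 ∧ ¬ L p.1 p.2

/-- `dim_s(I)`: least `d` such that `I` can be partitioned into `d` reversible sets. -/
noncomputable def dimOn [PartialOrder α] (s : Set α) (I : Set (α × α)) : ℕ :=
  sInf {d | ∃ J : Fin d → Set (α × α), (⋃ i, J i) = I ∧
    (Pairwise fun i j => Disjoint (J i) (J j)) ∧ ∀ i, ReversibleOn s (J i)}

/-- `dim_s(A, B)`. -/
noncomputable def dimAB [PartialOrder α] (s A B : Set α) : ℕ :=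
  dimOn s (IncOn s ∩ A ×ˢ B)

/-- Minimal elements of the poset induced on `s`. -/
def MinOn [PartialOrder α] (s : Set α) : Set α := {x | x ∈ s ∧ ∀ y ∈ s, y ≤ x → y = x}

/-- Maximal elements of the poset induced on `s`. -/
def MaxOn [PartialOrder α] (s : Set α) : Set α := {x | x ∈ s ∧ ∀ y ∈ s, x ≤ y → y = x}

/-- Up_P(S). -/
def UpSet [PartialOrder α] (S : Set α) : Set α := {y | ∃ x ∈ S, x ≤ y}

/-- Down_P(S). -/
def DownSet [PartialOrder α] (S : Set α) : Set α := {x | ∃ y ∈ S, x ≤ y}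

/-- The cover graph of a poset. -/
def coverGraph (α : Type*) [PartialOrder α] : SimpleGraph α :=
  SimpleGraph.fromRel (· ⋖ ·)

/-- The cover graph of the subposet induced on ground set `s`
(as a graph on the ambient type; vertices outside `s` are isolated). -/
def coverGraphOn [PartialOrder α] (s : Set α) : SimpleGraph α :=
  SimpleGraph.fromRel (fun x y => x ∈ s ∧ y ∈ s ∧ x < y ∧ ¬ ∃ z ∈ s, x < z ∧ z < y)

/-- The dimension of a poset: least size of a nonempty family of linear extensions
whose intersection is the partial order. -/
noncomputable def posetDim (α : Type*) [PartialOrder α] : ℕ :=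
  sInf {d | 0 < d ∧ ∃ L : Fin d → (α → α → Prop),
    (∀ i, LinExtOn Set.univ (L i)) ∧ ∀ x y : α, x ≤ y ↔ ∀ i, L i x y}

/-- The height of a poset: maximum size of a chain. -/
noncomputable def posetHeight (α : Type*) [PartialOrder α] : ℕ :=
  sSup {n | ∃ l : List α, l.Chain' (· < ·) ∧ l.length = n}

universe u

/-- The poset obtained from `α` by attaching a new minimal element (side `-1`) below every
non-minimal element and a new maximal element (side `1`) above every non-maximal element. -/
@[ext]
structure PendantExtension (α : Type u) [PartialOrder α] where
  base : α
  side : SignType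
  not_isMin : side = -1 → ¬ IsMin base
  not_isMax : side = 1 → ¬ IsMax base

namespace PendantExtension

variable {α : Type u} [PartialOrder α]

instance : PartialOrder (PendantExtension α) where
  le p q := p = q ∨ (p.base ≤ q.base ∧ p.side ≤ 0 ∧ 0 ≤ q.side)
  le_refl p := Or.inl rfl
  le_trans p q r := by
    rintro (rfl | ⟨h₁, h₂, h₃⟩) (rfl | ⟨h₄, h₅, h₆⟩)
    · exact Or.inl rfl
    · exact Or.inr ⟨h₄, h₅, h₆⟩
    · exact Or.inr ⟨h₁, h₂, h₃⟩
    · exact Or.inr ⟨h₁.trans h₄, h₂, h₆⟩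
  le_antisymm p q := by
    rintro (h | ⟨h₁, h₂, h₃⟩) (h' | ⟨h₄, h₅, h₆⟩)
    · exact h
    · exact h
    · exact h'.symm
    · exact PendantExtension.ext (le_antisymm h₁ h₄)
        ((le_antisymm h₂ h₆).trans (le_antisymm h₅ h₃).symm)

theorem le_def {p q : PendantExtension α} :
    p ≤ q ↔ p = q ∨ (p.base ≤ q.base ∧ p.side ≤ 0 ∧ 0 ≤ q.side) := Iff.rfl

theorem base_mono {p q : PendantExtension α} (h : p ≤ q) : p.base ≤ q.base := by
  rcases h with rfl | h
  · exact le_rfl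
  · exact h.1

theorem lt_iff {p q : PendantExtension α} :
    p < q ↔ p ≠ q ∧ p.base ≤ q.base ∧ p.side ≤ 0 ∧ 0 ≤ q.side := by
  rw [lt_iff_le_and_ne, le_def]
  tauto

instance [Finite α] : Finite (PendantExtension α) :=
  Finite.of_injective (fun p : PendantExtension α => (p.base, p.side)) fun p q h => by
    simp only [Prod.mk.injEq] at h
    exact PendantExtension.ext h.1 h.2

/-- The inclusion of the original poset. -/
def incl : α ↪o PendantExtension α where
  toFun x := ⟨x, 0, fun h => absurd h (by decide), fun h => absurd h (by decide)⟩
  inj' x y h := congrArg base h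
  map_rel_iff' {x y} := by
    constructor
    · rintro (h | h)
      · exact (congrArg base h).le
      · exact h.1
    · exact fun h => Or.inr ⟨h, le_rfl, le_rfl⟩

@[simp] theorem side_incl (x : α) : (incl x).side = 0 := rfl

theorem incl_base {p : PendantExtension α} (h : p.side = 0) : incl p.base = p :=
  PendantExtension.ext rfl h.symm

theorem side_eq_zero_of_lt_of_lt {p q r : PendantExtension α} (h₁ : p < q) (h₂ : q < r) :
    q.side = 0 :=
  le_antisymm (lt_iff.1 h₂).2.2.1 (lt_iff.1 h₁).2.2.2

theorem incl_covBy_incl {x y : α} : incl x ⋖ incl y ↔ x ⋖ y := by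
  refine ⟨fun h => h.of_image incl, fun h => ⟨incl.lt_iff_lt.2 h.lt, fun r h₁ h₂ => ?_⟩⟩
  obtain ⟨z, rfl⟩ : ∃ z, incl z = r := ⟨_, incl_base (side_eq_zero_of_lt_of_lt h₁ h₂)⟩
  exact h.2 (incl.lt_iff_lt.1 h₁) (incl.lt_iff_lt.1 h₂)

theorem coverGraph_adj_incl (x y : α) :
    (coverGraph (PendantExtension α)).Adj (incl x) (incl y) ↔ (coverGraph α).Adj x y := by
  simp only [coverGraph, SimpleGraph.fromRel_adj, incl_covBy_incl, ne_eq,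
    incl.injective.eq_iff]

theorem lt_incl_base {p : PendantExtension α} (h : p.side = -1) : p < incl p.base := by
  rw [lt_iff]
  refine ⟨fun e => ?_, le_rfl, by rw [h]; decide, le_rfl⟩
  have := congrArg side e
  rw [h] at this
  exact absurd this (by simp)

theorem incl_base_lt {p : PendantExtension α} (h : p.side = 1) : incl p.base < p := by
  rw [lt_iff]
  refine ⟨fun e => ?_, le_rfl, le_rfl, by rw [h]; decide⟩
  have := congrArg side e
  rw [h] at this
  exact absurd this (by simp)

theorem not_lt_of_side_neg {p q : PendantExtension α} (h : p.side = -1) : ¬ q < p := by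
  rw [lt_iff, h]
  exact fun h => absurd h.2.2.2 (by decide)

theorem not_lt_of_side_pos {p q : PendantExtension α} (h : p.side = 1) : ¬ p < q := by
  rw [lt_iff, h]
  exact fun h => absurd h.2.2.1 (by decide)

theorem incl_base_le_of_lt {p q : PendantExtension α} (h : p < q) : incl p.base ≤ q :=
  Or.inr ⟨(lt_iff.1 h).2.1, le_rfl, (lt_iff.1 h).2.2.2⟩

theorem le_incl_base_of_lt {p q : PendantExtension α} (h : p < q) : p ≤ incl q.base :=
  Or.inr ⟨(lt_iff.1 h).2.1, (lt_iff.1 h).2.2.1, le_rfl⟩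

theorem covBy_iff_of_side_neg {p q : PendantExtension α} (h : p.side = -1) :
    p ⋖ q ↔ q = incl p.base := by
  constructor
  · intro hc
    by_contra hne
    exact hc.2 (lt_incl_base h) (lt_of_le_of_ne (incl_base_le_of_lt hc.lt) (Ne.symm hne))
  · rintro rfl
    exact ⟨lt_incl_base h, fun r h₁ h₂ => (incl_base_le_of_lt h₁).not_gt h₂⟩

theorem covBy_iff_of_side_pos {p q : PendantExtension α} (h : p.side = 1) :
    q ⋖ p ↔ q = incl p.base := by
  constructor
  · intro hc
    by_contra hne
    exact hc.2 (lt_of_le_of_ne (le_incl_base_of_lt hc.lt) hne) (incl_base_lt h)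
  · rintro rfl
    exact ⟨incl_base_lt h, fun r h₁ h₂ => (le_incl_base_of_lt h₂).not_gt h₁⟩

theorem existsUnique_coverGraph_adj {p : PendantExtension α} (hp : p ∉ Set.range incl) :
    ∃! q, (coverGraph (PendantExtension α)).Adj p q := by
  have hadj : ∀ q, (coverGraph (PendantExtension α)).Adj p q ↔ q = incl p.base := by
    intro q
    have hne : p ≠ incl p.base := fun e => hp ⟨_, e.symm⟩
    simp only [coverGraph, SimpleGraph.fromRel_adj]
    rcases hs : p.side
    · exact absurd ⟨_, incl_base hs⟩ hp
    · rw [covBy_iff_of_side_neg hs]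
      constructor
      · rintro ⟨-, h | h⟩
        · exact h
        · exact absurd h.lt (not_lt_of_side_neg hs)
      · rintro rfl
        exact ⟨hne, Or.inl rfl⟩
    · rw [covBy_iff_of_side_pos hs]
      constructor
      · rintro ⟨-, h | h⟩
        · exact absurd h.lt (not_lt_of_side_pos hs)
        · exact h
      · rintro rfl
        exact ⟨hne, Or.inr rfl⟩
  exact ⟨incl p.base, (hadj _).2 rfl, fun q hq => (hadj q).1 hq⟩

theorem exists_strictMono : ∃ f : PendantExtension α → α, StrictMono f := by
  have key : ∀ p : PendantExtension α, ∃ x, (p.side = 0 → x = p.base) ∧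
      (p.side = -1 → x < p.base) ∧ (p.side = 1 → p.base < x) := by
    intro p
    rcases hs : p.side
    · exact ⟨p.base, by simp⟩
    · obtain ⟨x, hx⟩ := not_isMin_iff.1 (p.not_isMin hs)
      exact ⟨x, by simp [hx]⟩
    · obtain ⟨x, hx⟩ := not_isMax_iff.1 (p.not_isMax hs)
      exact ⟨x, by simp [hx]⟩
  choose f h₀ hneg hpos using key
  refine ⟨f, fun p q hpq => ?_⟩
  obtain ⟨hne, hb, hp, hq⟩ := lt_iff.1 hpq
  have hp' : p.side = 0 ∨ p.side = -1 := by
    revert hp; generalize p.side = s; revert s; decide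
  have hq' : q.side = 0 ∨ q.side = 1 := by
    revert hq; generalize q.side = s; revert s; decide
  rcases hp' with hp' | hp' <;> rcases hq' with hq' | hq'
  · rw [h₀ p hp', h₀ q hq']
    exact lt_of_le_of_ne hb fun e => hne (PendantExtension.ext e (hp'.trans hq'.symm))
  · rw [h₀ p hp']
    exact hb.trans_lt (hpos q hq')
  · rw [h₀ q hq']
    exact (hneg p hp').trans_le hb
  · exact ((hneg p hp').trans_le hb).trans (hpos q hq')

theorem exists_mem_minOn (x : α) :
    ∃ m ∈ MinOn (Set.univ : Set (PendantExtension α)), m.base = x ∧ m ≤ incl x := by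
  by_cases hx : IsMin x
  · refine ⟨incl x, ⟨trivial, fun q _ hq => ?_⟩, rfl, le_rfl⟩
    by_contra hne
    have hlt := lt_of_le_of_ne hq hne
    have hb : q.base = x := le_antisymm (base_mono hq) (hx (base_mono hq))
    rcases hs : q.side
    · exact hne (by rw [← hb]; exact (incl_base hs).symm)
    · exact q.not_isMin hs (hb ▸ hx)
    · exact not_lt_of_side_pos hs hlt
  · refine ⟨⟨x, -1, fun _ => hx, fun h => absurd h (by decide)⟩, ⟨trivial, fun q _ hq => ?_⟩,
      rfl, Or.inr ⟨le_rfl, show (-1 : SignType) ≤ 0 by decide, le_rfl⟩⟩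
    by_contra hne
    exact not_lt_of_side_neg rfl (lt_of_le_of_ne hq hne)

theorem exists_mem_maxOn (x : α) :
    ∃ m ∈ MaxOn (Set.univ : Set (PendantExtension α)), m.base = x ∧ incl x ≤ m := by
  by_cases hx : IsMax x
  · refine ⟨incl x, ⟨trivial, fun q _ hq => ?_⟩, rfl, le_rfl⟩
    by_contra hne
    have hlt := lt_of_le_of_ne hq (Ne.symm hne)
    have hb : q.base = x := le_antisymm (hx (base_mono hq)) (base_mono hq)
    rcases hs : q.side
    · exact hne (by rw [← hb]; exact (incl_base hs).symm)
    · exact not_lt_of_side_neg hs hlt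
    · exact q.not_isMax hs (hb ▸ hx)
  · refine ⟨⟨x, 1, fun h => absurd h (by decide), fun _ => hx⟩, ⟨trivial, fun q _ hq => ?_⟩,
      rfl, Or.inr ⟨le_rfl, le_rfl, show (0 : SignType) ≤ 1 by decide⟩⟩
    by_contra hne
    exact not_lt_of_side_pos rfl (lt_of_le_of_ne hq (Ne.symm hne))

theorem exists_mem_incOn_minOn_maxOn {a b : α} (hab : ¬ a ≤ b) (hba : ¬ b ≤ a) :
    ∃ p ∈ IncOn (Set.univ : Set (PendantExtension α)) ∩
      MinOn (Set.univ : Set (PendantExtension α)) ×ˢ MaxOn (Set.univ : Set (PendantExtension α)),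
      p.1 ≤ incl a ∧ incl b ≤ p.2 := by
  obtain ⟨m, hm, rfl, hma⟩ := exists_mem_minOn a
  obtain ⟨n, hn, rfl, hnb⟩ := exists_mem_maxOn b
  exact ⟨(m, n), ⟨⟨trivial, trivial, fun h => hab (base_mono h), fun h => hba (base_mono h)⟩,
    hm, hn⟩, hma, hnb⟩

end PendantExtension

theorem posetHeight_eq_of_strictMono {α β : Type*} [PartialOrder α] [PartialOrder β]
    {f : α → β} {g : β → α} (hf : StrictMono f) (hg : StrictMono g) :
    posetHeight β = posetHeight α := by
  unfold posetHeight
  congr 1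
  ext n
  constructor
  · rintro ⟨l, hl, rfl⟩
    exact ⟨l.map g, (List.isChain_map g).2 (hl.imp fun _ _ h => hg h), List.length_map _⟩
  · rintro ⟨l, hl, rfl⟩
    exact ⟨l.map f, (List.isChain_map f).2 (hl.imp fun _ _ h => hf h), List.length_map _⟩

/-- Any incomparable pair can be reversed by a linear extension. -/
theorem reversibleOn_singleton {α : Type*} [PartialOrder α] {p : α × α}
    (hp : p ∈ IncOn (Set.univ : Set α)) : ReversibleOn Set.univ {p} := by
  obtain ⟨a, b⟩ := p
  obtain ⟨-, -, hab, -⟩ := hp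
  let r : α → α → Prop := fun x y => x ≤ y ∨ (x ≤ b ∧ a ≤ y)
  have : IsPartialOrder α r :=
    { refl := fun x => Or.inl le_rfl
      trans := by
        rintro x y z (h | ⟨h₁, h₂⟩) (h' | ⟨h₃, h₄⟩)
        · exact Or.inl (h.trans h')
        · exact Or.inr ⟨h.trans h₃, h₄⟩
        · exact Or.inr ⟨h₁, h₂.trans h'⟩
        · exact Or.inr ⟨h₁, h₄⟩
      antisymm := by
        rintro x y (h | ⟨h₁, h₂⟩) (h' | ⟨h₃, h₄⟩)
        · exact le_antisymm h h'
        · exact absurd (h₄.trans (h.trans h₃)) hab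
        · exact absurd (h₂.trans (h'.trans h₁)) hab
        · exact absurd (h₂.trans h₃) hab }
  obtain ⟨s, hs, hrs⟩ := extend_partialOrder r
  have hba : s b a := hrs _ _ (Or.inr ⟨le_rfl, le_rfl⟩)
  refine ⟨s, ⟨fun x _ => refl_of s x, fun x _ y _ => antisymm_of s,
    fun x _ y _ z _ => trans_of s, fun x _ y _ => total_of s x y,
    fun x _ y _ h => hrs _ _ (Or.inl h)⟩, ?_⟩
  rintro _ rfl
  exact ⟨hba, fun h => hab (antisymm_of s h hba).le⟩

theorem exists_partition_reversibleOn {α : Type*} [PartialOrder α] [Finite α] {I : Set (α × α)}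
    (hI : I ⊆ IncOn Set.univ) :
    ∃ (d : ℕ) (J : Fin d → Set (α × α)), (⋃ i, J i) = I ∧
      (Pairwise fun i j => Disjoint (J i) (J j)) ∧ ∀ i, ReversibleOn Set.univ (J i) := by
  obtain ⟨d, ⟨e⟩⟩ := Finite.exists_equiv_fin I
  refine ⟨d, fun i => {(e.symm i : α × α)}, ?_, fun i j hij => ?_,
    fun i => reversibleOn_singleton (hI (e.symm i).2)⟩
  · ext p
    simp only [Set.mem_iUnion, Set.mem_singleton_iff]
    constructor
    · rintro ⟨i, rfl⟩
      exact (e.symm i).2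
    · exact fun hp => ⟨e ⟨p, hp⟩, by simp⟩
  · simpa [Subtype.ext_iff] using fun h => hij (e.symm.injective (Subtype.ext h))

theorem LinExtOn.comap {α β : Type*} [PartialOrder α] [PartialOrder β] {L : β → β → Prop}
    (hL : LinExtOn Set.univ L) (i : α ↪o β) :
    LinExtOn Set.univ fun x y => L (i x) (i y) := by
  obtain ⟨h₁, h₂, h₃, h₄, h₅⟩ := hL
  exact ⟨fun x _ => h₁ _ trivial,
    fun x _ y _ h h' => i.injective (h₂ _ trivial _ trivial h h'),
    fun x _ y _ z _ => h₃ _ trivial _ trivial _ trivial,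
    fun x _ y _ => h₄ _ trivial _ trivial,
    fun x _ y _ h => h₅ _ trivial _ trivial (i.le_iff_le.2 h)⟩

theorem posetDim_le_one_of_total {α : Type*} [PartialOrder α] (h : ∀ x y : α, x ≤ y ∨ y ≤ x) :
    posetDim α ≤ 1 :=
  Nat.sInf_le ⟨one_pos, fun _ => (· ≤ ·),
    fun _ => ⟨fun _ _ => le_rfl, fun _ _ _ _ => le_antisymm, fun _ _ _ _ _ _ => le_trans,
      fun x _ y _ => h x y, fun _ _ _ _ => id⟩,
    fun _ _ => ⟨fun h _ => h, fun h => h 0⟩⟩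

theorem posetDim_le_dimAB_of_orderEmbedding {α β : Type*} [PartialOrder α] [PartialOrder β]
    [Finite β] (h2 : 2 ≤ posetDim α) (i : α ↪o β) {A B : Set β}
    (h : ∀ a b : α, ¬ a ≤ b → ¬ b ≤ a →
      ∃ p ∈ IncOn (Set.univ : Set β) ∩ A ×ˢ B, p.1 ≤ i a ∧ i b ≤ p.2) :
    posetDim α ≤ dimAB Set.univ A B := by
  unfold dimAB dimOn
  refine le_csInf (exists_partition_reversibleOn Set.inter_subset_left) ?_
  rintro d ⟨J, hJ, -, hrev⟩
  choose L hL hLJ using hrev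
  have key : ∀ a b : α, ¬ a ≤ b → ¬ b ≤ a → ∃ k, ¬ L k (i a) (i b) := by
    intro a b hab hba
    obtain ⟨p, hp, hpa, hpb⟩ := h a b hab hba
    rw [← hJ] at hp
    obtain ⟨k, hk⟩ := Set.mem_iUnion.1 hp
    obtain ⟨-, -, htrans, -, hext⟩ := hL k
    refine ⟨k, fun hLab => (hLJ k p hk).2 ?_⟩
    exact htrans _ trivial _ trivial _ trivial (hext _ trivial _ trivial hpa)
      (htrans _ trivial _ trivial _ trivial hLab (hext _ trivial _ trivial hpb))
  have hd : 0 < d := by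
    by_contra hd
    have : posetDim α ≤ 1 := posetDim_le_one_of_total fun x y => by
      by_contra! hxy
      obtain ⟨k, -⟩ := key x y hxy.1 hxy.2
      exact hd k.pos
    omega
  refine Nat.sInf_le ⟨hd, fun k x y => L k (i x) (i y), fun k => (hL k).comap i, fun x y => ?_⟩
  refine ⟨fun hxy k => ((hL k).comap i).2.2.2.2 x trivial y trivial hxy, fun hall => ?_⟩
  by_contra hxy
  by_cases hyx : y ≤ x
  · have hk := (hL ⟨0, hd⟩).comap i
    exact hxy (hk.2.1 x trivial y trivial (hall _) (hk.2.2.2.2 y trivial x trivial hyx)).le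
  · obtain ⟨k, hk⟩ := key x y hxy hyx
    exact hk (hall k)

/-- For every finite poset `P` with `dim(P) ≥ 2` there is a finite
superposet `P'` (given by an order embedding `i : P ↪o P'`) such that the cover graph
of `P'` restricted to `P` equals the cover graph of `P` and every new element has
degree 1, the heights agree, and `dim(P) ≤ dim_{P'}(Min(P'), Max(P'))`. -/
theorem stmt_2 (α : Type u) [PartialOrder α] [Fintype α]
    (h2 : 2 ≤ posetDim α) :
    ∃ (β : Type u) (_ : PartialOrder β) (_ : Fintype β) (i : α ↪o β),
      ((∀ x y : α, (coverGraph β).Adj (i x) (i y) ↔ (coverGraph α).Adj x y) ∧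
        (∀ b : β, b ∉ Set.range i → ∃! c : β, (coverGraph β).Adj b c)) ∧
      posetHeight β = posetHeight α ∧
      posetDim α ≤ dimAB (Set.univ : Set β) (MinOn (Set.univ : Set β)) (MaxOn (Set.univ : Set β)) := by
  obtain ⟨f, hf⟩ := PendantExtension.exists_strictMono (α := α)
  exact ⟨PendantExtension α, inferInstance, Fintype.ofFinite _, PendantExtension.incl,
    ⟨PendantExtension.coverGraph_adj_incl,
      fun _ => PendantExtension.existsUnique_coverGraph_adj⟩,
    posetHeight_eq_of_strictMono PendantExtension.incl.strictMono hf,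
    posetDim_le_dimAB_of_orderEmbedding h2 PendantExtension.incl
      fun _ _ => PendantExtension.exists_mem_incOn_minOn_maxOn⟩
end

section
/- Let P be a connected finite poset, let x_0 ∈ Min(P), and let (A_0, B_1, A_1, B_2, ...) be the unfolding of P from x_0. Then the sets A_0, A_1, A_2, ... are pairwise disjoint and their union is Min(P), and the sets B_1, B_2, ... are pairwise disjoint and their union is Max(P). -/
variable {α : Type*}

/-- The unfolding of a poset from `x0`: `(unfolding x0 n).1 = A_n` and
`(unfolding x0 n).2 = B_{n+1}`, where `A_0 = {x0}`, `B_1 = Up({x0}) ∩ Max(P)`,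
`A_i = (Down(B_i) ∩ Min(P)) \ A_{i-1}` and `B_{i+1} = (Up(A_i) ∩ Max(P)) \ B_i`. -/
def unfolding [PartialOrder α] (x0 : α) : ℕ → Set α × Set α
  | 0 => ({x0}, UpSet {x0} ∩ MaxOn Set.univ)
  | n + 1 =>
    let A := (DownSet (unfolding x0 n).2 ∩ MinOn Set.univ) \ (unfolding x0 n).1
    (A, (UpSet A ∩ MaxOn Set.univ) \ (unfolding x0 n).2)

theorem exists_minOn_univ_le [PartialOrder α] [Finite α] (x : α) :
    ∃ m ∈ MinOn (Set.univ : Set α), m ≤ x := by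
  obtain ⟨m, hmx, hm⟩ := Finite.exists_le_minimal (p := fun _ : α => True) (a := x) trivial
  exact ⟨m, ⟨trivial, fun y _ hy => le_antisymm hy (hm.2 trivial hy)⟩, hmx⟩

theorem exists_maxOn_univ_ge [PartialOrder α] [Finite α] (x : α) :
    ∃ M ∈ MaxOn (Set.univ : Set α), x ≤ M := by
  obtain ⟨M, hxM, hM⟩ := Finite.exists_le_maximal (p := fun _ : α => True) (a := x) trivial
  exact ⟨M, ⟨trivial, fun y _ hy => le_antisymm (hM.2 trivial hy) hy⟩, hxM⟩

section Unfolding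

variable [PartialOrder α] {x0 : α}

theorem unfolding_fst_subset (hx0 : x0 ∈ MinOn (Set.univ : Set α)) (n : ℕ) :
    (unfolding x0 n).1 ⊆ MinOn Set.univ := by
  cases n with
  | zero => rintro x rfl; exact hx0
  | succ n => exact fun x hx => hx.1.2

theorem unfolding_snd_subset (n : ℕ) : (unfolding x0 n).2 ⊆ MaxOn Set.univ := by
  cases n with
  | zero => exact fun x hx => hx.2
  | succ n => exact fun x hx => hx.1.2

theorem exists_fst_le_of_mem_snd {n : ℕ} {y : α} (hy : y ∈ (unfolding x0 n).2) :
    ∃ z ∈ (unfolding x0 n).1, z ≤ y := by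
  cases n with
  | zero => exact hy.1
  | succ n => exact hy.1.1

/-- The maximal elements above `A_n` lie in `B_n ∪ B_{n+1}`. -/
theorem mem_snd_of_fst_le {n : ℕ} {z y : α} (hz : z ∈ (unfolding x0 n).1)
    (hy : y ∈ MaxOn Set.univ) (h : z ≤ y) :
    y ∈ (unfolding x0 n).2 ∨ ∃ m, n = m + 1 ∧ y ∈ (unfolding x0 m).2 := by
  cases n with
  | zero => exact Or.inl ⟨⟨z, hz, h⟩, hy⟩
  | succ n =>
    by_cases hn : y ∈ (unfolding x0 n).2
    · exact Or.inr ⟨n, rfl, hn⟩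
    · exact Or.inl ⟨⟨⟨z, hz, h⟩, hy⟩, hn⟩

/-- The minimal elements below `B_{n+1}` lie in `A_n ∪ A_{n+1}`. -/
theorem mem_fst_of_le_snd {n : ℕ} {z y : α} (hy : y ∈ (unfolding x0 n).2)
    (hz : z ∈ MinOn Set.univ) (h : z ≤ y) :
    z ∈ (unfolding x0 n).1 ∨ z ∈ (unfolding x0 (n + 1)).1 := by
  by_cases hn : z ∈ (unfolding x0 n).1
  · exact Or.inl hn
  · exact Or.inr ⟨⟨⟨y, hy, h⟩, hz⟩, hn⟩

theorem unfolding_disjoint_of_lt (hx0 : x0 ∈ MinOn (Set.univ : Set α)) (j : ℕ) :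
    (∀ i < j, Disjoint (unfolding x0 i).1 (unfolding x0 j).1) ∧
      ∀ i < j, Disjoint (unfolding x0 i).2 (unfolding x0 j).2 := by
  induction j with
  | zero => simp
  | succ j ih =>
    have hA : ∀ i < j + 1, Disjoint (unfolding x0 i).1 (unfolding x0 (j + 1)).1 := by
      intro i hi
      refine Set.disjoint_left.2 fun x hxi hxj => ?_
      obtain rfl | hij := Nat.lt_succ_iff_lt_or_eq.1 hi |>.symm
      · exact hxj.2 hxi
      obtain ⟨y, hy, hxy⟩ := hxj.1.1
      rcases mem_snd_of_fst_le hxi (unfolding_snd_subset j hy) hxy with h | ⟨m, rfl, h⟩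
      · exact Set.disjoint_left.1 (ih.2 i hij) h hy
      · exact Set.disjoint_left.1 (ih.2 m (by omega)) h hy
    refine ⟨hA, fun i hi => Set.disjoint_left.2 fun y hyi hyj => ?_⟩
    obtain rfl | hij := Nat.lt_succ_iff_lt_or_eq.1 hi |>.symm
    · exact hyj.2 hyi
    obtain ⟨z, hz, hzy⟩ := hyj.1.1
    rcases mem_fst_of_le_snd hyi (unfolding_fst_subset hx0 (j + 1) hz) hzy with h | h
    · exact Set.disjoint_left.1 (hA i hi) h hz
    · exact Set.disjoint_left.1 (hA (i + 1) (by omega)) h hz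

theorem mem_iUnion_snd_of_le {z y : α} (hz : z ∈ ⋃ i, (unfolding x0 i).1)
    (hy : y ∈ MaxOn Set.univ) (h : z ≤ y) : y ∈ ⋃ i, (unfolding x0 i).2 := by
  obtain ⟨i, hi⟩ := Set.mem_iUnion.1 hz
  rcases mem_snd_of_fst_le hi hy h with h | ⟨m, -, h⟩
  exacts [Set.mem_iUnion.2 ⟨i, h⟩, Set.mem_iUnion.2 ⟨m, h⟩]

theorem mem_iUnion_fst_of_le {z y : α} (hy : y ∈ ⋃ i, (unfolding x0 i).2)
    (hz : z ∈ MinOn Set.univ) (h : z ≤ y) : z ∈ ⋃ i, (unfolding x0 i).1 := by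
  obtain ⟨i, hi⟩ := Set.mem_iUnion.1 hy
  rcases mem_fst_of_le_snd hi hz h with h | h
  exacts [Set.mem_iUnion.2 ⟨i, h⟩, Set.mem_iUnion.2 ⟨i + 1, h⟩]

theorem exists_mem_iUnion_fst_le [Finite α] (hconn : (coverGraph α).Connected) (x : α) :
    ∃ z ∈ ⋃ i, (unfolding x0 i).1, z ≤ x := by
  have step : ∀ u v, (coverGraph α).Adj u v → (∃ z ∈ ⋃ i, (unfolding x0 i).1, z ≤ u) →
      ∃ z ∈ ⋃ i, (unfolding x0 i).1, z ≤ v := by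
    rintro u v huv ⟨z, hz, hzu⟩
    rcases ((SimpleGraph.fromRel_adj _ _ _).1 huv).2 with h | h
    · exact ⟨z, hz, hzu.trans h.le⟩
    · obtain ⟨M, hM, huM⟩ := exists_maxOn_univ_ge u
      obtain ⟨m, hm, hmv⟩ := exists_minOn_univ_le v
      exact ⟨m, mem_iUnion_fst_of_le (mem_iUnion_snd_of_le hz hM (hzu.trans huM)) hm
        (hmv.trans (h.le.trans huM)), hmv⟩
  obtain ⟨w⟩ := hconn.preconnected x0 x
  have walk : ∀ {u v : α}, (coverGraph α).Walk u v →
      (∃ z ∈ ⋃ i, (unfolding x0 i).1, z ≤ u) → ∃ z ∈ ⋃ i, (unfolding x0 i).1, z ≤ v := by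
    intro u v w
    induction w with
    | nil => exact id
    | cons h _ ih => exact fun hu => ih (step _ _ h hu)
  exact walk w ⟨x0, Set.mem_iUnion.2 ⟨0, rfl⟩, le_rfl⟩

end Unfolding

/-- For a connected finite poset `P` and `x0 ∈ Min(P)`, the sets
`A_0, A_1, A_2, ...` of the unfolding of `P` from `x0` are pairwise disjoint with
union `Min(P)`, and the sets `B_1, B_2, ...` are pairwise disjoint with union `Max(P)`. -/
theorem stmt_5 (α : Type*) [PartialOrder α] [Fintype α]
    (hconn : (coverGraph α).Connected) (x0 : α)
    (hx0 : x0 ∈ MinOn (Set.univ : Set α)) :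
    (Pairwise fun i j : ℕ => Disjoint (unfolding x0 i).1 (unfolding x0 j).1) ∧
    (⋃ i : ℕ, (unfolding x0 i).1) = MinOn (Set.univ : Set α) ∧
    (Pairwise fun i j : ℕ => Disjoint (unfolding x0 i).2 (unfolding x0 j).2) ∧
    (⋃ i : ℕ, (unfolding x0 i).2) = MaxOn (Set.univ : Set α) := by
  refine ⟨?_, ?_, ?_, ?_⟩
  · exact (pairwise_disjoint_on _).2 fun i j hij => (unfolding_disjoint_of_lt hx0 j).1 i hij
  · refine Set.Subset.antisymm (Set.iUnion_subset (unfolding_fst_subset hx0)) fun x hx => ?_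
    obtain ⟨z, hz, hzx⟩ := exists_mem_iUnion_fst_le (x0 := x0) hconn x
    rwa [← hx.2 z trivial hzx]
  · exact (pairwise_disjoint_on _).2 fun i j hij => (unfolding_disjoint_of_lt hx0 j).2 i hij
  · refine Set.Subset.antisymm (Set.iUnion_subset unfolding_snd_subset) fun x hx => ?_
    obtain ⟨z, hz, hzx⟩ := exists_mem_iUnion_fst_le (x0 := x0) hconn x
    exact mem_iUnion_snd_of_le hz hx hzx
end

section
/- Let k be a positive integer and let n = 4k+3. In the cover graph of the Kelly poset K_n, for each i ∈ [2k+1] the vertex set V_i = {a_{2i}, c_{2i}, c_{2i-1}, b_{2i}, d_{2i}, d_{2i-1}} induces a cycle of length 6 (with edges a_{2i}c_{2i}, c_{2i}c_{2i-1}, c_{2i-1}b_{2i}, b_{2i}d_{2i}, d_{2i}d_{2i-1}, d_{2i-1}a_{2i}), and the sets V_1, ..., V_{2k+1} are pairwise disjoint. -/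
/-- The element `a_j = {j}` of the Kelly poset (with `1 ≤ j ≤ n`, 1-based). -/
def kellyA (n j : ℕ) : Finset (Fin n) := Finset.univ.filter (fun x => x.val + 1 = j)

/-- The element `b_j = [n] \ {j}` of the Kelly poset (with `1 ≤ j ≤ n`, 1-based). -/
def kellyB (n j : ℕ) : Finset (Fin n) := Finset.univ.filter (fun x => x.val + 1 ≠ j)

/-- The element `c_j = {1, ..., j}` of the Kelly poset (with `1 ≤ j ≤ n-1`, 1-based). -/
def kellyC (n j : ℕ) : Finset (Fin n) := Finset.univ.filter (fun x => x.val + 1 ≤ j)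

/-- The element `d_j = {j+1, ..., n}` of the Kelly poset (with `1 ≤ j ≤ n-1`, 1-based). -/
def kellyD (n j : ℕ) : Finset (Fin n) := Finset.univ.filter (fun x => j ≤ x.val)

/-- The ground set of the Kelly poset `K_n`, a subposet of the power set of `[n]`
ordered by inclusion. -/
def kellyGround (n : ℕ) : Set (Finset (Fin n)) :=
  {s | (∃ j, 1 ≤ j ∧ j ≤ n ∧ s = kellyA n j) ∨
       (∃ j, 1 ≤ j ∧ j ≤ n ∧ s = kellyB n j) ∨
       (∃ j, 1 ≤ j ∧ j ≤ n - 1 ∧ s = kellyC n j) ∨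
       (∃ j, 1 ≤ j ∧ j ≤ n - 1 ∧ s = kellyD n j)}

/-- The cover graph of the Kelly poset `K_n`, as a graph on the ambient power set:
two elements of the ground set are adjacent when one covers the other in `K_n`
(vertices outside the ground set are isolated). -/
def kellyCoverGraph (n : ℕ) : SimpleGraph (Finset (Fin n)) :=
  SimpleGraph.fromRel (fun x y => x ∈ kellyGround n ∧ y ∈ kellyGround n ∧ x ⊂ y ∧
    ¬ ∃ z ∈ kellyGround n, x ⊂ z ∧ z ⊂ y)

/-- The six vertices `a_{2i}, c_{2i}, c_{2i-1}, b_{2i}, d_{2i}, d_{2i-1}` of the set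
`V_i` listed in cyclic order. -/
def kellyHex (n i : ℕ) : Fin 6 → Finset (Fin n) :=
  ![kellyA n (2 * i), kellyC n (2 * i), kellyC n (2 * i - 1),
    kellyB n (2 * i), kellyD n (2 * i), kellyD n (2 * i - 1)]

theorem mem_kellyA {n j : ℕ} {x : Fin n} : x ∈ kellyA n j ↔ x.val + 1 = j := by
  simp [kellyA]

theorem mem_kellyB {n j : ℕ} {x : Fin n} : x ∈ kellyB n j ↔ x.val + 1 ≠ j := by
  simp [kellyB]

theorem mem_kellyC {n j : ℕ} {x : Fin n} : x ∈ kellyC n j ↔ x.val + 1 ≤ j := by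
  simp [kellyC]

theorem mem_kellyD {n j : ℕ} {x : Fin n} : x ∈ kellyD n j ↔ j ≤ x.val := by
  simp [kellyD]

theorem kellyA_mem_ground {n j : ℕ} (h₁ : 1 ≤ j) (h₂ : j ≤ n) : kellyA n j ∈ kellyGround n :=
  Or.inl ⟨j, h₁, h₂, rfl⟩

theorem kellyB_mem_ground {n j : ℕ} (h₁ : 1 ≤ j) (h₂ : j ≤ n) : kellyB n j ∈ kellyGround n :=
  Or.inr (Or.inl ⟨j, h₁, h₂, rfl⟩)

theorem kellyC_mem_ground {n j : ℕ} (h₁ : 1 ≤ j) (h₂ : j ≤ n - 1) :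
    kellyC n j ∈ kellyGround n :=
  Or.inr (Or.inr (Or.inl ⟨j, h₁, h₂, rfl⟩))

theorem kellyD_mem_ground {n j : ℕ} (h₁ : 1 ≤ j) (h₂ : j ≤ n - 1) :
    kellyD n j ∈ kellyGround n :=
  Or.inr (Or.inr (Or.inr ⟨j, h₁, h₂, rfl⟩))

/-- Adjacency in the cover graph from a strict inclusion with nothing in between. -/
theorem kellyCoverGraph_adj_of_cover {n : ℕ} {X Y : Finset (Fin n)}
    (hX : X ∈ kellyGround n) (hY : Y ∈ kellyGround n) (hXY : X ⊆ Y) (hYX : ¬ Y ⊆ X)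
    (h : ∀ Z ∈ kellyGround n, X ⊆ Z → Z ⊆ Y → ∀ x ∈ Z, x ∉ X → ∀ y ∈ Y, y ∉ Z → False) :
    (kellyCoverGraph n).Adj X Y := by
  have hss : X ⊂ Y := ⟨hXY, hYX⟩
  refine (SimpleGraph.fromRel_adj _ _ _).2 ⟨hss.ne, Or.inl ⟨hX, hY, hss, ?_⟩⟩
  rintro ⟨Z, hZ, hXZ, hZY⟩
  obtain ⟨x, hxZ, hxX⟩ := Finset.not_subset.1 hXZ.2
  obtain ⟨y, hyY, hyZ⟩ := Finset.not_subset.1 hZY.2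
  exact h Z hZ hXZ.1 hZY.1 x hxZ hxX y hyY hyZ

theorem not_kellyCoverGraph_adj_of_incomparable {n : ℕ} {X Y : Finset (Fin n)}
    (hXY : ¬ X ⊆ Y) (hYX : ¬ Y ⊆ X) : ¬ (kellyCoverGraph n).Adj X Y := by
  intro h
  rcases ((SimpleGraph.fromRel_adj _ _ _).1 h).2 with h | h
  · exact hXY h.2.2.1.1
  · exact hYX h.2.2.1.1

theorem kellyCoverGraph_adj_hexagon {n m : ℕ} (h₁ : 2 ≤ m) (h₂ : m + 1 ≤ n) :
    (kellyCoverGraph n).Adj (kellyA n m) (kellyC n m) ∧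
    (kellyCoverGraph n).Adj (kellyC n (m - 1)) (kellyC n m) ∧
    (kellyCoverGraph n).Adj (kellyC n (m - 1)) (kellyB n m) ∧
    (kellyCoverGraph n).Adj (kellyD n m) (kellyB n m) ∧
    (kellyCoverGraph n).Adj (kellyD n m) (kellyD n (m - 1)) ∧
    (kellyCoverGraph n).Adj (kellyA n m) (kellyD n (m - 1)) := by
  have hA := kellyA_mem_ground (n := n) (j := m) (by omega) (by omega)
  have hB := kellyB_mem_ground (n := n) (j := m) (by omega) (by omega)
  have hC := kellyC_mem_ground (n := n) (j := m) (by omega) (by omega)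
  have hC' := kellyC_mem_ground (n := n) (j := m - 1) (by omega) (by omega)
  have hD := kellyD_mem_ground (n := n) (j := m) (by omega) (by omega)
  have hD' := kellyD_mem_ground (n := n) (j := m - 1) (by omega) (by omega)
  refine ⟨?_, ?_, ?_, ?_, ?_, ?_⟩
  · refine kellyCoverGraph_adj_of_cover hA hC (fun x hx => ?_) (fun h => ?_) ?_
    · simp only [mem_kellyA, mem_kellyC] at hx ⊢
      omega
    · have e := @h ⟨0, by omega⟩
      simp only [mem_kellyA, mem_kellyC] at e
      omega
    · intro Z hZ hXZ hZY x hxZ hxX y hyY hyZ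
      have hx := hZY hxZ
      have hy := mt (@hXZ y) hyZ
      have e1 := @hXZ ⟨m - 1, by omega⟩ (by simp only [mem_kellyA]; omega)
      have f5 := mt (@hZY ⟨n - 1, by omega⟩) (by simp only [mem_kellyC]; omega)
      clear hXZ hZY
      rcases hZ with ⟨j, -, hj, rfl⟩ | ⟨j, -, hj, rfl⟩ | ⟨j, -, hj, rfl⟩ | ⟨j, -, hj, rfl⟩ <;>
        simp only [mem_kellyA, mem_kellyB, mem_kellyC, mem_kellyD]
          at hxZ hxX hyY hyZ hx hy e1 f5 <;>
        omega
  · refine kellyCoverGraph_adj_of_cover hC' hC (fun x hx => ?_) (fun h => ?_) ?_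
    · simp only [mem_kellyC] at hx ⊢
      omega
    · have e := @h ⟨m - 1, by omega⟩
      simp only [mem_kellyC] at e
      omega
    · intro Z hZ hXZ hZY x hxZ hxX y hyY hyZ
      have hx := hZY hxZ
      have hy := mt (@hXZ y) hyZ
      clear hXZ hZY
      simp only [mem_kellyC] at hxX hyY hx hy
      have hxy : x = y := Fin.ext (by omega)
      exact hyZ (hxy ▸ hxZ)
  · refine kellyCoverGraph_adj_of_cover hC' hB (fun x hx => ?_) (fun h => ?_) ?_
    · simp only [mem_kellyB, mem_kellyC] at hx ⊢
      omega
    · have e := @h ⟨n - 1, by omega⟩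
      simp only [mem_kellyB, mem_kellyC] at e
      omega
    · intro Z hZ hXZ hZY x hxZ hxX y hyY hyZ
      have hx := hZY hxZ
      have hy := mt (@hXZ y) hyZ
      have e0 := @hXZ ⟨0, by omega⟩ (by simp only [mem_kellyC]; omega)
      have e2 := @hXZ ⟨m - 2, by omega⟩ (by simp only [mem_kellyC]; omega)
      have f1 := mt (@hZY ⟨m - 1, by omega⟩) (by simp only [mem_kellyB]; omega)
      clear hXZ hZY
      rcases hZ with ⟨j, -, hj, rfl⟩ | ⟨j, -, hj, rfl⟩ | ⟨j, -, hj, rfl⟩ | ⟨j, -, hj, rfl⟩ <;>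
        simp only [mem_kellyA, mem_kellyB, mem_kellyC, mem_kellyD]
          at hxZ hxX hyY hyZ hx hy e0 e2 f1 <;>
        omega
  · refine kellyCoverGraph_adj_of_cover hD hB (fun x hx => ?_) (fun h => ?_) ?_
    · simp only [mem_kellyB, mem_kellyD] at hx ⊢
      omega
    · have e := @h ⟨0, by omega⟩
      simp only [mem_kellyB, mem_kellyD] at e
      omega
    · intro Z hZ hXZ hZY x hxZ hxX y hyY hyZ
      have hx := hZY hxZ
      have hy := mt (@hXZ y) hyZ
      have e3 := @hXZ ⟨m, by omega⟩ (by simp only [mem_kellyD]; omega)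
      have e5 := @hXZ ⟨n - 1, by omega⟩ (by simp only [mem_kellyD]; omega)
      have f1 := mt (@hZY ⟨m - 1, by omega⟩) (by simp only [mem_kellyB]; omega)
      clear hXZ hZY
      rcases hZ with ⟨j, -, hj, rfl⟩ | ⟨j, -, hj, rfl⟩ | ⟨j, -, hj, rfl⟩ | ⟨j, -, hj, rfl⟩ <;>
        simp only [mem_kellyA, mem_kellyB, mem_kellyC, mem_kellyD]
          at hxZ hxX hyY hyZ hx hy e3 e5 f1 <;>
        omega
  · refine kellyCoverGraph_adj_of_cover hD hD' (fun x hx => ?_) (fun h => ?_) ?_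
    · simp only [mem_kellyD] at hx ⊢
      omega
    · have e := @h ⟨m - 1, by omega⟩
      simp only [mem_kellyD] at e
      omega
    · intro Z hZ hXZ hZY x hxZ hxX y hyY hyZ
      have hx := hZY hxZ
      have hy := mt (@hXZ y) hyZ
      clear hXZ hZY
      simp only [mem_kellyD] at hxX hyY hx hy
      have hxy : x = y := Fin.ext (by omega)
      exact hyZ (hxy ▸ hxZ)
  · refine kellyCoverGraph_adj_of_cover hA hD' (fun x hx => ?_) (fun h => ?_) ?_
    · simp only [mem_kellyA, mem_kellyD] at hx ⊢
      omega
    · have e := @h ⟨n - 1, by omega⟩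
      simp only [mem_kellyA, mem_kellyD] at e
      omega
    · intro Z hZ hXZ hZY x hxZ hxX y hyY hyZ
      have hx := hZY hxZ
      have hy := mt (@hXZ y) hyZ
      have e1 := @hXZ ⟨m - 1, by omega⟩ (by simp only [mem_kellyA]; omega)
      have f0 := mt (@hZY ⟨0, by omega⟩) (by simp only [mem_kellyD]; omega)
      clear hXZ hZY
      rcases hZ with ⟨j, -, hj, rfl⟩ | ⟨j, -, hj, rfl⟩ | ⟨j, -, hj, rfl⟩ | ⟨j, -, hj, rfl⟩ <;>
        simp only [mem_kellyA, mem_kellyB, mem_kellyC, mem_kellyD]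
          at hxZ hxX hyY hyZ hx hy e1 f0 <;>
        omega

theorem not_kellyCoverGraph_adj_hexagon {n m : ℕ} (h₁ : 2 ≤ m) (h₂ : m + 1 ≤ n) :
    ¬ (kellyCoverGraph n).Adj (kellyA n m) (kellyC n (m - 1)) ∧
    ¬ (kellyCoverGraph n).Adj (kellyA n m) (kellyB n m) ∧
    ¬ (kellyCoverGraph n).Adj (kellyA n m) (kellyD n m) ∧
    ¬ (kellyCoverGraph n).Adj (kellyC n m) (kellyB n m) ∧
    ¬ (kellyCoverGraph n).Adj (kellyC n m) (kellyD n m) ∧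
    ¬ (kellyCoverGraph n).Adj (kellyC n m) (kellyD n (m - 1)) ∧
    ¬ (kellyCoverGraph n).Adj (kellyC n (m - 1)) (kellyD n m) ∧
    ¬ (kellyCoverGraph n).Adj (kellyC n (m - 1)) (kellyD n (m - 1)) ∧
    ¬ (kellyCoverGraph n).Adj (kellyB n m) (kellyD n (m - 1)) := by
  refine ⟨?_, ?_, ?_, ?_, ?_, ?_, ?_, ?_, ?_⟩
  all_goals
    apply not_kellyCoverGraph_adj_of_incomparable <;> intro h <;>
    simp only [Finset.subset_iff, mem_kellyA, mem_kellyB, mem_kellyC, mem_kellyD] at h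
  all_goals
    have e₁ := h (x := ⟨0, by omega⟩)
    have e₂ := h (x := ⟨m - 2, by omega⟩)
    have e₃ := h (x := ⟨m - 1, by omega⟩)
    have e₄ := h (x := ⟨m, by omega⟩)
    have e₅ := h (x := ⟨n - 1, by omega⟩)
    clear h
    dsimp only at *
    omega

theorem kellyA_inj {n p q : ℕ} (hp : 1 ≤ p) (hp' : p ≤ n) (h : kellyA n p = kellyA n q) :
    p = q := by
  have e := Finset.ext_iff.1 h ⟨p - 1, by omega⟩
  simp only [mem_kellyA] at e
  omega

theorem kellyB_inj {n p q : ℕ} (hp : 1 ≤ p) (hp' : p ≤ n) (h : kellyB n p = kellyB n q) :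
    p = q := by
  have e := Finset.ext_iff.1 h ⟨p - 1, by omega⟩
  simp only [mem_kellyB] at e
  omega

theorem kellyC_inj {n p q : ℕ} (hp : 1 ≤ p) (hp' : p ≤ n) (hq : 1 ≤ q) (hq' : q ≤ n)
    (h : kellyC n p = kellyC n q) : p = q := by
  have e := Finset.ext_iff.1 h ⟨p - 1, by omega⟩
  have f := Finset.ext_iff.1 h ⟨q - 1, by omega⟩
  simp only [mem_kellyC] at e f
  omega

theorem kellyD_inj {n p q : ℕ} (hp : p < n) (hq : q < n) (h : kellyD n p = kellyD n q) :
    p = q := by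
  have e := Finset.ext_iff.1 h ⟨p, hp⟩
  have f := Finset.ext_iff.1 h ⟨q, hq⟩
  simp only [mem_kellyD] at e f
  omega

theorem kellyA_ne_kellyB {n p q : ℕ} (hn : 3 ≤ n) : kellyA n p ≠ kellyB n q := by
  intro h
  have e := Finset.ext_iff.1 h ⟨0, by omega⟩
  have f := Finset.ext_iff.1 h ⟨1, by omega⟩
  have g := Finset.ext_iff.1 h ⟨2, by omega⟩
  simp only [mem_kellyA, mem_kellyB] at e f g
  omega

theorem kellyA_ne_kellyC {n p q : ℕ} (hp : 2 ≤ p) (hq : 1 ≤ q) (hn : 1 ≤ n) :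
    kellyA n p ≠ kellyC n q := by
  intro h
  have e := Finset.ext_iff.1 h ⟨0, by omega⟩
  simp only [mem_kellyA, mem_kellyC] at e
  omega

theorem kellyA_ne_kellyD {n p q : ℕ} (hp : p < n) (hq : q < n) : kellyA n p ≠ kellyD n q := by
  intro h
  have e := Finset.ext_iff.1 h ⟨n - 1, by omega⟩
  simp only [mem_kellyA, mem_kellyD] at e
  omega

theorem kellyB_ne_kellyC {n p q : ℕ} (hp : p < n) (hq : q < n) : kellyB n p ≠ kellyC n q := by
  intro h
  have e := Finset.ext_iff.1 h ⟨n - 1, by omega⟩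
  simp only [mem_kellyB, mem_kellyC] at e
  omega

theorem kellyB_ne_kellyD {n p q : ℕ} (hp : 2 ≤ p) (hq : 1 ≤ q) (hn : 1 ≤ n) :
    kellyB n p ≠ kellyD n q := by
  intro h
  have e := Finset.ext_iff.1 h ⟨0, by omega⟩
  simp only [mem_kellyB, mem_kellyD] at e
  omega

theorem kellyC_ne_kellyD {n p q : ℕ} (hp : 1 ≤ p) (hq : 1 ≤ q) (hn : 1 ≤ n) :
    kellyC n p ≠ kellyD n q := by
  intro h
  have e := Finset.ext_iff.1 h ⟨0, by omega⟩
  simp only [mem_kellyC, mem_kellyD] at e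
  omega

set_option maxHeartbeats 1000000 in
theorem kellyHex_inj {n i j : ℕ} (hi : 1 ≤ i) (hi' : 2 * i + 1 ≤ n) (hj : 1 ≤ j)
    (hj' : 2 * j + 1 ≤ n) {r s : Fin 6} (h : kellyHex n i r = kellyHex n j s) :
    i = j ∧ r = s := by
  fin_cases r <;> fin_cases s <;>
    simp only [kellyHex, Fin.zero_eta, Fin.mk_one, Fin.reduceFinMk, Matrix.cons_val] at h
  all_goals first
    | have e := kellyA_inj (by omega) (by omega) h
      exact ⟨by omega, rfl⟩
    | have e := kellyB_inj (by omega) (by omega) h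
      exact ⟨by omega, rfl⟩
    | have e := kellyC_inj (by omega) (by omega) (by omega) (by omega) h
      first | exact ⟨by omega, rfl⟩ | omega
    | have e := kellyD_inj (by omega) (by omega) h
      first | exact ⟨by omega, rfl⟩ | omega
    | exact absurd h (kellyA_ne_kellyB (by omega))
    | exact absurd h.symm (kellyA_ne_kellyB (by omega))
    | exact absurd h (kellyA_ne_kellyC (by omega) (by omega) (by omega))
    | exact absurd h.symm (kellyA_ne_kellyC (by omega) (by omega) (by omega))
    | exact absurd h (kellyA_ne_kellyD (by omega) (by omega))
    | exact absurd h.symm (kellyA_ne_kellyD (by omega) (by omega))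
    | exact absurd h (kellyB_ne_kellyC (by omega) (by omega))
    | exact absurd h.symm (kellyB_ne_kellyC (by omega) (by omega))
    | exact absurd h (kellyB_ne_kellyD (by omega) (by omega) (by omega))
    | exact absurd h.symm (kellyB_ne_kellyD (by omega) (by omega) (by omega))
    | exact absurd h (kellyC_ne_kellyD (by omega) (by omega) (by omega))
    | exact absurd h.symm (kellyC_ne_kellyD (by omega) (by omega) (by omega))

/-- For a positive integer `k` and `n = 4k+3`, in the cover graph of the
Kelly poset `K_n`, for each `i ∈ [2k+1]` the six vertices
`a_{2i}, c_{2i}, c_{2i-1}, b_{2i}, d_{2i}, d_{2i-1}` are distinct and induce a cycle of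
length 6 whose edges are exactly the cyclically consecutive pairs in that order
(namely `a_{2i}c_{2i}`, `c_{2i}c_{2i-1}`, `c_{2i-1}b_{2i}`, `b_{2i}d_{2i}`,
`d_{2i}d_{2i-1}`, `d_{2i-1}a_{2i}`), and the vertex sets `V_1, ..., V_{2k+1}` are
pairwise disjoint. -/
theorem stmt_12 (k : ℕ) (hk : 1 ≤ k) :
    (∀ i : ℕ, 1 ≤ i → i ≤ 2 * k + 1 →
      Function.Injective (kellyHex (4 * k + 3) i) ∧
      ∀ r s : Fin 6,
        (kellyCoverGraph (4 * k + 3)).Adj (kellyHex (4 * k + 3) i r) (kellyHex (4 * k + 3) i s) ↔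
          (s = r + 1 ∨ r = s + 1)) ∧
    (∀ i j : ℕ, 1 ≤ i → i ≤ 2 * k + 1 → 1 ≤ j → j ≤ 2 * k + 1 → i ≠ j →
      ∀ r s : Fin 6, kellyHex (4 * k + 3) i r ≠ kellyHex (4 * k + 3) j s) := by
  refine ⟨fun i hi hi' => ⟨fun r s h => ?_, fun r s => ?_⟩, fun i j hi hi' hj hj' hij r s h => ?_⟩
  · exact (kellyHex_inj hi (by omega) hi (by omega) h).2
  · obtain ⟨a₁, a₂, a₃, a₄, a₅, a₆⟩ :=
      kellyCoverGraph_adj_hexagon (n := 4 * k + 3) (m := 2 * i) (by omega) (by omega)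
    obtain ⟨b₁, b₂, b₃, b₄, b₅, b₆, b₇, b₈, b₉⟩ :=
      not_kellyCoverGraph_adj_hexagon (n := 4 * k + 3) (m := 2 * i) (by omega) (by omega)
    fin_cases r <;> fin_cases s <;>
      simp [kellyHex, a₁, a₂, a₃, a₄, a₅, a₆, a₁.symm, a₂.symm, a₃.symm, a₄.symm, a₅.symm,
        a₆.symm, b₁, b₂, b₃, b₄, b₅, b₆, b₇, b₈, b₉, mt SimpleGraph.Adj.symm b₁,
        mt SimpleGraph.Adj.symm b₂, mt SimpleGraph.Adj.symm b₃, mt SimpleGraph.Adj.symm b₄,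
        mt SimpleGraph.Adj.symm b₅, mt SimpleGraph.Adj.symm b₆, mt SimpleGraph.Adj.symm b₇,
        mt SimpleGraph.Adj.symm b₈, mt SimpleGraph.Adj.symm b₉]
  · exact hij (kellyHex_inj hi (by omega) hj (by omega) h).1
end
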